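/- arXiv:0912.1502 — 2 statements merged into one kernel-verified Lean document; each statement's English description precedes it below -/
import Mathlib

section
/- Let K be a field, K[X] = K[x_1,…,x_n], I ⊆ K[X] a zero-dimensional ideal, and d = dim_K K[X]/I. Let O ⊆ T^n_{≤d−1} be a set of monomials with |O| = d. Then ⟨O⟩_K ∩ I = {0} (i.e., the image of O in K[X]/I is linearly independent over K) if and only if for every subset U ⊆ T^n_{≤d−1} with |U| = d one has |U ∩ O| ≤ dim_K (⟨U⟩_K + I)/I. -/
open MvPolynomial

/-- Total degree of a monomial given by its exponent vector. -/
def mdeg {n : ℕ} (m : Fin n →₀ ℕ) : ℕ := m.sum fun _ k => k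

/-- The `K`-vector subspace of `K[X]` spanned by a set of monomials. -/
noncomputable def monSpan (K : Type*) [Field K] {n : ℕ} (O : Set (Fin n →₀ ℕ)) :
    Submodule K (MvPolynomial (Fin n) K) :=
  Submodule.span K ((fun m => (monomial m (1 : K))) '' O)

theorem finrank_monSpan (K : Type*) [Field K] {n : ℕ} (O : Finset (Fin n →₀ ℕ)) :
    Module.finrank K (monSpan K (O : Set (Fin n →₀ ℕ))) = O.card := by
  have h : LinearIndependent K fun m : (Fin n →₀ ℕ) => (monomial m (1 : K)) := by
    simpa [coe_basisMonomials] using (basisMonomials (Fin n) K).linearIndependent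
  have h' := finrank_span_eq_card (h.comp ((↑) : O → (Fin n →₀ ℕ)) Subtype.val_injective)
  rw [Set.range_comp, Subtype.range_coe_subtype, Fintype.card_coe] at h'
  exact h'

instance finiteDimensional_monSpan (K : Type*) [Field K] {n : ℕ} (O : Finset (Fin n →₀ ℕ)) :
    FiniteDimensional K (monSpan K (O : Set (Fin n →₀ ℕ))) :=
  FiniteDimensional.span_of_finite K (O.finite_toSet.image _)

theorem monSpan_mono (K : Type*) [Field K] {n : ℕ} {S T : Set (Fin n →₀ ℕ)} (h : S ⊆ T) :
    monSpan K S ≤ monSpan K T :=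
  Submodule.span_mono (Set.image_mono h)

/-- A linear map preserves the dimension of a finite-dimensional subspace exactly when the
subspace meets the kernel trivially. -/
theorem finrank_map_eq_iff_inf_ker_eq_bot {K V W : Type*} [Field K] [AddCommGroup V] [Module K V]
    [AddCommGroup W] [Module K W] (f : V →ₗ[K] W) (p : Submodule K V) [FiniteDimensional K p] :
    Module.finrank K (p.map f) = Module.finrank K p ↔ p ⊓ LinearMap.ker f = ⊥ := by
  have h := (f.domRestrict p).finrank_range_add_finrank_ker
  rw [LinearMap.range_domRestrict] at h
  have hk : p ⊓ LinearMap.ker f = ⊥ ↔ LinearMap.ker (f.domRestrict p) = ⊥ := by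
    rw [LinearMap.ker_domRestrict, ← Submodule.disjoint_iff_comap_eq_bot, disjoint_iff]
  rw [hk, ← Submodule.finrank_eq_zero (R := K)]
  omega

/-- for a zero-dimensional ideal `I` with `d = dim_K K[X]/I`
and a set `O ⊆ T^n_{≤d-1}` of monomials with `|O| = d`, one has
`⟨O⟩_K ∩ I = {0}` iff for every `U ⊆ T^n_{≤d-1}` with `|U| = d`,
`|U ∩ O| ≤ dim_K (⟨U⟩_K + I)/I`. -/
theorem monSpan_inter_ideal_eq_bot_iff {n : ℕ} {K : Type*} [Field K]
    (I : Ideal (MvPolynomial (Fin n) K))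
    (hI : FiniteDimensional K (MvPolynomial (Fin n) K ⧸ I))
    (d : ℕ) (hd : d = Module.finrank K (MvPolynomial (Fin n) K ⧸ I))
    (O : Finset (Fin n →₀ ℕ)) (hOdeg : ∀ m ∈ O, mdeg m ≤ d - 1)
    (hOcard : O.card = d) :
    monSpan K (O : Set (Fin n →₀ ℕ)) ⊓ Submodule.restrictScalars K I = ⊥ ↔
      ∀ U : Finset (Fin n →₀ ℕ), (∀ m ∈ U, mdeg m ≤ d - 1) → U.card = d →
        (U ∩ O).card ≤ Module.finrank K
          ↥(Submodule.map (Ideal.Quotient.mkₐ K I).toLinearMap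
            (monSpan K (U : Set (Fin n →₀ ℕ)))) := by
  have hker : LinearMap.ker (Ideal.Quotient.mkₐ K I).toLinearMap =
      Submodule.restrictScalars K I := by
    ext x
    simp [Ideal.Quotient.eq_zero_iff_mem]
  rw [← hker]
  constructor
  · intro h U _ _
    have hle : monSpan K ((U ∩ O : Finset _) : Set (Fin n →₀ ℕ)) ≤ monSpan K (O : Set _) :=
      monSpan_mono K (Finset.coe_subset.2 Finset.inter_subset_right)
    rw [← finrank_monSpan K (U ∩ O), ← (finrank_map_eq_iff_inf_ker_eq_bot _ _).2
      (eq_bot_mono (inf_le_inf_right _ hle) h)]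
    exact Submodule.finrank_mono (Submodule.map_mono
      (monSpan_mono K (Finset.coe_subset.2 Finset.inter_subset_left)))
  · intro h
    have hO := h O hOdeg hOcard
    rw [Finset.inter_self, ← finrank_monSpan K O] at hO
    exact (finrank_map_eq_iff_inf_ker_eq_bot _ _).1 (le_antisymm (Submodule.finrank_map_le _ _) hO)
end

section
/- Let K be a field of characteristic zero, n ∈ ℕ, k ∈ {1,…,n}, and in K[x_1,…,x_n] let v_j = Σ_{i=1}^n i^j x_i for j ∈ {1,…,n−k} and F_{n,k} = {v_j : j ∈ [n−k]} ∪ T^n_{=3}. Then the ideal ⟨F_{n,k}⟩ is zero-dimensional, and an order ideal O supports a border basis of ⟨F_{n,k}⟩ if and only if: O^{=1} is a set of k distinct variables among x_1,…,x_n, O^{=2} = {x·y : x, y ∈ O^{=1}}, and O^{=ℓ} = ∅ for all ℓ ≥ 3 (where O^{=i} denotes the monomials of O of total degree exactly i). -/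
open MvPolynomial

/-- An order ideal: a finite set of monomials (represented by their exponent
vectors) closed under divisibility (`t' ∣ t` corresponds to `t' ≤ t`). -/
def IsOrderIdeal {n : ℕ} (O : Finset (Fin n →₀ ℕ)) : Prop :=
  ∀ t ∈ O, ∀ t' : Fin n →₀ ℕ, t' ≤ t → t' ∈ O

/-- The linear form `v_j = ∑_{i=1}^n i^j x_i`. -/
noncomputable def vlin (K : Type*) [Field K] (n j : ℕ) : MvPolynomial (Fin n) K :=
  ∑ i : Fin n, C ((((i : ℕ) + 1) ^ j : ℕ) : K) * X i

/-- The set `F_{n,k} = {v_j : j ∈ [n-k]} ∪ T^n_{=3}`. -/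
noncomputable def Fnk (K : Type*) [Field K] (n k : ℕ) : Set (MvPolynomial (Fin n) K) :=
  (Set.range fun j : Fin (n - k) => vlin K n ((j : ℕ) + 1)) ∪
    ((fun m => monomial m (1 : K)) '' {m : Fin n →₀ ℕ | mdeg m = 3})

theorem mdeg_eq_degree {n : ℕ} (m : Fin n →₀ ℕ) : mdeg m = m.degree := rfl

theorem monSpan_eq_restrictSupport (K : Type*) [Field K] {n : ℕ} (O : Set (Fin n →₀ ℕ)) :
    monSpan K O = restrictSupport K O :=
  (restrictSupport_eq_span K O).symm

/-- The monomials of degree at most two in the variables indexed by `S`. -/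
def quadMonomials {n : ℕ} (S : Finset (Fin n)) : Set (Fin n →₀ ℕ) :=
  {m | m.degree ≤ 2 ∧ m.support ⊆ S}

theorem finite_quadMonomials {n : ℕ} (S : Finset (Fin n)) : (quadMonomials S).Finite :=
  (Finsupp.finite_of_degree_le 2).subset fun _ hm => hm.1

theorem exists_eq_add_of_degree_eq_two {n : ℕ} {m : Fin n →₀ ℕ} (hm : m.degree = 2) :
    ∃ a b : Fin n →₀ ℕ, a.degree = 1 ∧ b.degree = 1 ∧ m = a + b := by
  obtain ⟨a, ha, hda⟩ := m.exists_le_degree_eq 1 (by omega)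
  obtain ⟨b, rfl⟩ := le_iff_exists_add.mp ha
  refine ⟨a, b, hda, ?_, rfl⟩
  rw [map_add] at hm
  omega

theorem exists_eq_single_of_degree_eq_one {n : ℕ} {m : Fin n →₀ ℕ} (hm : m.degree = 1) :
    ∃ i, m = Finsupp.single i 1 := by
  have h : m ∈ Set.range (fun a : Fin n => Finsupp.single a 1) := by
    rw [Finsupp.range_single_one]
    exact hm
  obtain ⟨i, rfl⟩ := h
  exact ⟨i, rfl⟩

/-- The variables lying in a set of monomials. -/
noncomputable def variablesIn {n : ℕ} (O : Finset (Fin n →₀ ℕ)) : Finset (Fin n) :=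
  Finset.univ.filter fun i => Finsupp.single i 1 ∈ O

theorem mem_variablesIn {n : ℕ} {O : Finset (Fin n →₀ ℕ)} {i : Fin n} :
    i ∈ variablesIn O ↔ Finsupp.single i 1 ∈ O := by
  simp [variablesIn]

theorem card_filter_mdeg_eq_one {n : ℕ} (O : Finset (Fin n →₀ ℕ)) :
    (O.filter fun m => mdeg m = 1).card = (variablesIn O).card := by
  symm
  refine Finset.card_bij (fun i _ => Finsupp.single i 1) ?_ ?_ ?_
  · intro i hi
    rw [Finset.mem_filter]
    exact ⟨mem_variablesIn.mp hi, Finsupp.degree_single i 1⟩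
  · intro i _ j _ h
    exact Finsupp.single_left_injective one_ne_zero h
  · intro m hm
    rw [Finset.mem_filter] at hm
    obtain ⟨i, rfl⟩ := exists_eq_single_of_degree_eq_one hm.2
    exact ⟨i, mem_variablesIn.mpr hm.1, rfl⟩

theorem IsOrderIdeal.support_subset_variablesIn {n : ℕ} {O : Finset (Fin n →₀ ℕ)}
    (hO : IsOrderIdeal O) {m : Fin n →₀ ℕ} (hm : m ∈ O) : m.support ⊆ variablesIn O := by
  intro i hi
  refine mem_variablesIn.mpr (hO m hm _ ?_)
  rw [Finsupp.single_le_iff]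
  exact Nat.one_le_iff_ne_zero.mpr (Finsupp.mem_support_iff.mp hi)

theorem variablesIn_eq_of_coe_eq {n : ℕ} {O : Finset (Fin n →₀ ℕ)} {S : Finset (Fin n)}
    (h : (O : Set (Fin n →₀ ℕ)) = quadMonomials S) : variablesIn O = S := by
  ext i
  rw [mem_variablesIn, ← Finset.mem_coe, h]
  simp [quadMonomials]

theorem isOrderIdeal_conditions_iff {n k : ℕ} (hk : 1 ≤ k) {O : Finset (Fin n →₀ ℕ)}
    (hO : IsOrderIdeal O) :
    ((O.filter fun m => mdeg m = 1).card = k ∧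
      (∀ m : Fin n →₀ ℕ, (m ∈ O ∧ mdeg m = 2) ↔
        ∃ a b : Fin n →₀ ℕ, (a ∈ O ∧ mdeg a = 1) ∧ (b ∈ O ∧ mdeg b = 1) ∧ m = a + b) ∧
      (∀ l : ℕ, 3 ≤ l → ∀ m ∈ O, mdeg m ≠ l)) ↔
    ∃ S : Finset (Fin n), S.card = k ∧ (O : Set (Fin n →₀ ℕ)) = quadMonomials S := by
  rw [card_filter_mdeg_eq_one]
  simp only [mdeg_eq_degree]
  constructor
  · rintro ⟨hcard, htwo, hthree⟩
    refine ⟨variablesIn O, hcard, Set.ext fun m => ⟨fun hm => ⟨?_, ?_⟩, ?_⟩⟩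
    · by_contra h
      exact hthree m.degree (by omega) m hm rfl
    · exact hO.support_subset_variablesIn hm
    · rintro ⟨hdeg, hsupp⟩
      have hsingle : ∀ a ≤ m, a.degree = 1 → a ∈ O := by
        intro a ha hda
        obtain ⟨i, rfl⟩ := exists_eq_single_of_degree_eq_one hda
        refine mem_variablesIn.mp (hsupp ?_)
        rw [Finsupp.mem_support_iff]
        rw [Finsupp.single_le_iff] at ha
        omega
      obtain h | h | h : m.degree = 0 ∨ m.degree = 1 ∨ m.degree = 2 := by omega
      · obtain ⟨i, hi⟩ := Finset.card_pos.mp (by omega : 0 < (variablesIn O).card)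
        rw [Finsupp.degree_eq_zero_iff] at h
        subst h
        exact hO _ (mem_variablesIn.mp hi) _ zero_le
      · exact hsingle m le_rfl h
      · obtain ⟨a, b, ha, hb, rfl⟩ := exists_eq_add_of_degree_eq_two h
        exact ((htwo (a + b)).mpr ⟨a, b, ⟨hsingle a le_self_add ha, ha⟩,
          ⟨hsingle b le_add_self hb, hb⟩, rfl⟩).1
  · rintro ⟨S, hcard, hS⟩
    have hmem : ∀ m, m ∈ O ↔ m.degree ≤ 2 ∧ m.support ⊆ S := fun m => by
      rw [← Finset.mem_coe, hS]
      rfl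
    refine ⟨variablesIn_eq_of_coe_eq hS ▸ hcard, fun m => ⟨?_, ?_⟩, ?_⟩
    · rintro ⟨hm, hdeg⟩
      obtain ⟨a, b, ha, hb, rfl⟩ := exists_eq_add_of_degree_eq_two hdeg
      exact ⟨a, b, ⟨hO _ hm _ le_self_add, ha⟩, ⟨hO _ hm _ le_add_self, hb⟩, rfl⟩
    · rintro ⟨a, b, ⟨ha, hda⟩, ⟨hb, hdb⟩, rfl⟩
      have hdeg : (a + b).degree = 2 := by rw [map_add, hda, hdb]
      exact ⟨(hmem _).mpr ⟨hdeg.le, Finsupp.support_add.trans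
        (Finset.union_subset ((hmem a).mp ha).2 ((hmem b).mp hb).2)⟩, hdeg⟩
    · intro l hl m hm hdeg
      have := ((hmem m).mp hm).1
      omega

theorem det_pow_succ_ne_zero {K : Type*} [Field K] {r : ℕ} {a : Fin r → K}
    (ha : Function.Injective a) (ha0 : ∀ i, a i ≠ 0) :
    (Matrix.of fun i j : Fin r => a i ^ ((j : ℕ) + 1)).det ≠ 0 := by
  have h : (Matrix.of fun i j : Fin r => a i ^ ((j : ℕ) + 1)) =
      Matrix.diagonal a * Matrix.vandermonde a := by
    ext i j
    simp [Matrix.diagonal_mul, Matrix.vandermonde_apply, pow_succ']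
  rw [h, Matrix.det_mul, Matrix.det_diagonal]
  exact mul_ne_zero (Finset.prod_ne_zero_iff.mpr fun i _ => ha0 i)
    (Matrix.det_vandermonde_ne_zero_iff.mpr ha)

/-- The matrix of coefficients of the `v_j` has a right inverse supported on the rows outside `S`,
which is also a left inverse on these rows. -/
theorem exists_inverse_off (K : Type*) [Field K] [CharZero K] {n k : ℕ} (S : Finset (Fin n))
    (hS : S.card = k) :
    ∃ D : Fin n → Fin (n - k) → K, (∀ i ∈ S, ∀ j, D i j = 0) ∧
      (∀ j j' : Fin (n - k), ∑ i : Fin n, ((((i : ℕ) + 1) ^ ((j : ℕ) + 1) : ℕ) : K) * D i j' =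
        if j = j' then 1 else 0) ∧
      (∀ i ∉ S, ∀ i' ∉ S, ∑ j, D i j * ((((i' : ℕ) + 1) ^ ((j : ℕ) + 1) : ℕ) : K) =
        if i = i' then 1 else 0) := by
  have hc : Fintype.card {i : Fin n // i ∉ S} = n - k := by
    simp [Fintype.card_subtype_compl, hS]
  let e : {i : Fin n // i ∉ S} ≃ Fin (n - k) := Fintype.equivFinOfCardEq hc
  let a : Fin (n - k) → K := fun l => ((((e.symm l : Fin n) : ℕ) + 1 : ℕ) : K)
  have ha : Function.Injective a := by
    intro l l' h
    have h' := Nat.cast_injective (R := K) h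
    exact e.symm.injective (Subtype.ext (Fin.ext (by omega)))
  have hdet := det_pow_succ_ne_zero ha fun l => Nat.cast_ne_zero.mpr (Nat.succ_ne_zero _)
  set A : Matrix (Fin (n - k)) (Fin (n - k)) K :=
    Matrix.of fun i j => a i ^ ((j : ℕ) + 1) with hA
  have hu : IsUnit A.det := hdet.isUnit
  have hAe : ∀ i : {i : Fin n // i ∉ S}, ∀ j : Fin (n - k),
      (((((i : Fin n) : ℕ) + 1) ^ ((j : ℕ) + 1) : ℕ) : K) = A (e i) j := by
    intro i j
    simp [hA, a]
  refine ⟨fun i j => if h : i ∉ S then A⁻¹ j (e ⟨i, h⟩) else 0, ?_, ?_, ?_⟩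
  · intro i hi j
    simp [hi]
  · intro j j'
    have h1 : ∑ l, A⁻¹ j' l * A l j = if j' = j then 1 else 0 := by
      rw [← Matrix.mul_apply, Matrix.nonsing_inv_mul A hu, Matrix.one_apply]
    rw [← Finset.sum_subset (Finset.subset_univ Sᶜ) (fun i _ hi => by
      rw [Finset.mem_compl, not_not] at hi
      simp [hi]), Finset.sum_subtype (p := fun i => i ∉ S) Sᶜ (by simp), ← e.symm.sum_comp]
    simp only [eq_comm (a := j)]
    rw [← h1]
    refine Finset.sum_congr rfl fun l _ => ?_
    rw [hAe, dif_pos (e.symm l).2, mul_comm]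
    simp
  · intro i hi i' hi'
    have h1 : ∑ j, A (e ⟨i', hi'⟩) j * A⁻¹ j (e ⟨i, hi⟩) =
        if e ⟨i', hi'⟩ = e ⟨i, hi⟩ then 1 else 0 := by
      rw [← Matrix.mul_apply, Matrix.mul_nonsing_inv A hu, Matrix.one_apply]
    simp only [e.injective.eq_iff, Subtype.mk.injEq] at h1
    simp only [eq_comm (a := i)]
    rw [← h1]
    refine Finset.sum_congr rfl fun j _ => ?_
    rw [dif_pos hi, ← hAe ⟨i', hi'⟩, mul_comm]

theorem vlin_mem_span_Fnk (K : Type*) [Field K] {n k : ℕ} (j : Fin (n - k)) :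
    vlin K n ((j : ℕ) + 1) ∈ Ideal.span (Fnk K n k) :=
  Ideal.subset_span (Or.inl ⟨j, rfl⟩)

theorem span_Fnk (K : Type*) [Field K] (n k : ℕ) :
    Ideal.span (Fnk K n k) =
      Ideal.span (Set.range fun j : Fin (n - k) => vlin K n ((j : ℕ) + 1)) ⊔
        idealOfVars (Fin n) K ^ 3 := by
  rw [Fnk, Ideal.span_union, pow_idealOfVars_eq_span]
  rfl

theorem monomial_mem_span_Fnk {K : Type*} [Field K] {n k : ℕ} {m : Fin n →₀ ℕ}
    (hm : 3 ≤ m.degree) (c : K) : monomial m c ∈ Ideal.span (Fnk K n k) := by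
  obtain rfl | hc := eq_or_ne c 0
  · simp
  · rw [span_Fnk]
    exact Ideal.mem_sup_right ((monomial_mem_pow_idealOfVars_iff 3 m hc).mpr hm)

theorem support_subset_of_mem_supported {K σ : Type*} [CommSemiring K] {S : Finset σ}
    {p : MvPolynomial σ K} (hp : p ∈ supported K (S : Set σ)) {m : σ →₀ ℕ} (hm : m ∈ p.support) :
    m.support ⊆ S := by
  rw [mem_supported] at hp
  intro i hi
  exact hp (Finset.mem_coe.mpr ((mem_vars_iff_mem_support i).mpr ⟨m, hm, hi⟩))

theorem mem_supported_of_mem_restrictSupport_quadMonomials {K : Type*} [Field K] {n : ℕ}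
    {S : Finset (Fin n)} {p : MvPolynomial (Fin n) K}
    (hp : p ∈ restrictSupport K (quadMonomials S)) : p ∈ supported K (S : Set (Fin n)) := by
  rw [mem_supported]
  intro i hi
  obtain ⟨m, hm, him⟩ := (mem_vars_iff_mem_support i).mp (Finset.mem_coe.mp hi)
  exact (hp hm).2 him

/-- Modulo `⟨F_{n,k}⟩` every polynomial can be rewritten in any `k` of the variables. -/
theorem exists_elimination (K : Type*) [Field K] [CharZero K] {n k : ℕ} (S : Finset (Fin n))
    (hS : S.card = k) :
    ∃ φ : MvPolynomial (Fin n) K →ₐ[K] MvPolynomial (Fin n) K,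
      (∀ p, φ p ∈ supported K (S : Set (Fin n))) ∧
      (∀ p ∈ supported K (S : Set (Fin n)), φ p = p) ∧
      (∀ p, p - φ p ∈ Ideal.span (Fnk K n k)) ∧
      (∀ p ∈ Ideal.span (Fnk K n k), φ p ∈ idealOfVars (Fin n) K ^ 3) ∧
      (∀ i, φ (X i) ∈ Submodule.span K (X '' (S : Set (Fin n)))) := by
  obtain ⟨D, hD0, hDr, hDl⟩ := exists_inverse_off K (k := k) S hS
  let g : Fin n → MvPolynomial (Fin n) K := fun i =>
    X i - ∑ j : Fin (n - k), D i j • vlin K n ((j : ℕ) + 1)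
  have hgS : ∀ i ∈ S, g i = X i := fun i hi => by simp [g, hD0 i hi]
  have hg : ∀ i, g i ∈ Submodule.span K (X '' (S : Set (Fin n))) := by
    intro i
    by_cases hi : i ∈ S
    · rw [hgS i hi]
      exact Submodule.subset_span ⟨i, hi, rfl⟩
    have h1 : ∑ j : Fin (n - k), D i j • vlin K n ((j : ℕ) + 1) = ∑ i' : Fin n,
        (∑ j : Fin (n - k), D i j * ((((i' : ℕ) + 1) ^ ((j : ℕ) + 1) : ℕ) : K)) •
          (X i' : MvPolynomial (Fin n) K) := by
      simp only [vlin, ← smul_eq_C_mul, Finset.smul_sum, smul_smul, Finset.sum_smul]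
      exact Finset.sum_comm
    have h2 : ∀ i', i' ∈ Sᶜ → (∑ j : Fin (n - k),
        D i j * ((((i' : ℕ) + 1) ^ ((j : ℕ) + 1) : ℕ) : K)) •
          (X i' : MvPolynomial (Fin n) K) = if i = i' then X i' else 0 := by
      intro i' hi'
      rw [hDl i hi i' (Finset.mem_compl.mp hi')]
      split_ifs <;> simp
    have h3 : g i = - ∑ i' ∈ S, (∑ j : Fin (n - k),
        D i j * ((((i' : ℕ) + 1) ^ ((j : ℕ) + 1) : ℕ) : K)) •
          (X i' : MvPolynomial (Fin n) K) := by
      simp only [g]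
      rw [h1, ← Finset.sum_add_sum_compl S, Finset.sum_congr rfl h2, Finset.sum_ite_eq,
        if_pos (Finset.mem_compl.mpr hi)]
      ring
    rw [h3]
    exact Submodule.neg_mem _ (Submodule.sum_mem _ fun i' hi' =>
      Submodule.smul_mem _ _ (Submodule.subset_span ⟨i', hi', rfl⟩))
  have hsupp : Submodule.span K (X '' (S : Set (Fin n))) ≤
      Subalgebra.toSubmodule (supported K (S : Set (Fin n))) :=
    Algebra.span_le_adjoin K _
  have hvars : Submodule.span K (X '' (S : Set (Fin n))) ≤
      (idealOfVars (Fin n) K).restrictScalars K := by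
    rw [Submodule.span_le]
    rintro _ ⟨i, -, rfl⟩
    exact Ideal.subset_span ⟨i, rfl⟩
  have hφv : ∀ j : Fin (n - k), aeval g (vlin K n ((j : ℕ) + 1)) = 0 := by
    intro j
    have h1 : aeval g (vlin K n ((j : ℕ) + 1)) = vlin K n ((j : ℕ) + 1) -
        ∑ j' : Fin (n - k), (∑ i : Fin n,
          ((((i : ℕ) + 1) ^ ((j : ℕ) + 1) : ℕ) : K) * D i j') • vlin K n ((j' : ℕ) + 1) := by
      conv_lhs => rw [vlin]
      simp only [map_sum, map_mul, aeval_X, aeval_C, ← Algebra.smul_def, g, smul_sub,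
        Finset.sum_sub_distrib, Finset.smul_sum, smul_smul, Finset.sum_smul]
      rw [Finset.sum_comm (s := Finset.univ (α := Fin n))]
      simp only [vlin, ← smul_eq_C_mul]
    rw [h1]
    simp only [hDr, ite_smul, one_smul, zero_smul, Finset.sum_ite_eq, Finset.mem_univ, if_true,
      sub_self]
  refine ⟨aeval g, ?_, ?_, ?_, ?_, fun i => by rw [aeval_X]; exact hg i⟩
  · intro p
    have h : (aeval g).range ≤ supported K (S : Set (Fin n)) := by
      rw [← Algebra.adjoin_range_eq_range_aeval, Algebra.adjoin_le_iff]
      rintro _ ⟨i, rfl⟩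
      exact hsupp (hg i)
    exact h ⟨p, rfl⟩
  · intro p hp
    have h : supported K (S : Set (Fin n)) ≤ AlgHom.equalizer (aeval g) (AlgHom.id K _) := by
      rw [supported, Algebra.adjoin_le_iff]
      rintro _ ⟨i, hi, rfl⟩
      simp [hgS i hi]
    exact h hp
  · intro p
    have h : Ideal.Quotient.mkₐ K (Ideal.span (Fnk K n k)) =
        (Ideal.Quotient.mkₐ K (Ideal.span (Fnk K n k))).comp (aeval g) := by
      refine algHom_ext fun i => ?_
      rw [AlgHom.comp_apply, aeval_X, Ideal.Quotient.mkₐ_eq_mk, Ideal.Quotient.mk_eq_mk_iff_sub_mem]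
      simp only [g, sub_sub_cancel]
      refine Ideal.sum_mem _ fun j _ => ?_
      rw [smul_eq_C_mul]
      exact Ideal.mul_mem_left _ _ (vlin_mem_span_Fnk K j)
    rw [← Ideal.Quotient.mk_eq_mk_iff_sub_mem]
    exact DFunLike.congr_fun h p
  · intro p hp
    have h : Ideal.span (Fnk K n k) ≤
        (idealOfVars (Fin n) K ^ 3).comap (aeval g : _ →ₐ[K] MvPolynomial (Fin n) K) := by
      rw [span_Fnk, sup_le_iff]
      constructor
      · rw [Ideal.span_le]
        rintro _ ⟨j, rfl⟩
        rw [SetLike.mem_coe, Ideal.mem_comap, hφv j]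
        exact Ideal.zero_mem _
      · rw [← Ideal.map_le_iff_le_comap, Ideal.map_pow]
        refine Ideal.pow_right_mono ?_ 3
        rw [Ideal.map_le_iff_le_comap, Ideal.span_le]
        rintro _ ⟨i, rfl⟩
        simpa using hvars (hg i)
    exact h hp

theorem isCompl_quadMonomials (K : Type*) [Field K] [CharZero K] {n k : ℕ} {S : Finset (Fin n)}
    (hS : S.card = k) :
    IsCompl ((Ideal.span (Fnk K n k)).restrictScalars K)
      (restrictSupport K (quadMonomials S)) := by
  obtain ⟨φ, hφS, hφid, hφsub, hφI, -⟩ := exists_elimination K (k := k) S hS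
  constructor
  · rw [Submodule.disjoint_def]
    intro p hpI hpS
    have h := hφI p hpI
    rw [hφid p (mem_supported_of_mem_restrictSupport_quadMonomials hpS),
      mem_pow_idealOfVars_iff] at h
    rw [← support_eq_empty]
    refine Finset.eq_empty_of_forall_notMem fun m hm => ?_
    have h1 := h m hm
    have h2 := (hpS hm).1
    omega
  · rw [codisjoint_iff, Submodule.eq_top_iff']
    intro p
    rw [← sub_add_cancel p (φ p)]
    refine Submodule.add_mem _ (Submodule.mem_sup_left (hφsub p)) ?_
    rw [(φ p).as_sum]
    refine Submodule.sum_mem _ fun m hm => ?_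
    obtain h | h := le_or_gt 3 m.degree
    · exact Submodule.mem_sup_left (monomial_mem_span_Fnk h _)
    · exact Submodule.mem_sup_right ((monomial_mem_restrictSupport K).mpr
        (Or.inl ⟨by omega, support_subset_of_mem_supported (hφS p) hm⟩))

theorem isCompl_iff_exists_quadMonomials (K : Type*) [Field K] [CharZero K] {n k : ℕ}
    (hkn : k ≤ n) {O : Finset (Fin n →₀ ℕ)} (hO : IsOrderIdeal O) :
    IsCompl ((Ideal.span (Fnk K n k)).restrictScalars K)
        (restrictSupport K (O : Set (Fin n →₀ ℕ))) ↔
      ∃ S : Finset (Fin n), S.card = k ∧ (O : Set (Fin n →₀ ℕ)) = quadMonomials S := by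
  constructor
  · intro h
    have hdeg : ∀ m ∈ O, m.degree ≤ 2 := by
      intro m hm
      by_contra hlt
      have h0 := Submodule.disjoint_def.mp h.disjoint (monomial m 1)
        (monomial_mem_span_Fnk (by omega) 1) ((monomial_mem_restrictSupport K).mpr (Or.inl hm))
      exact one_ne_zero (monomial_eq_zero.mp h0)
    have hX : ∀ i ∈ variablesIn O, (X i : MvPolynomial (Fin n) K) ∈
        restrictSupport K (O : Set (Fin n →₀ ℕ)) := fun i hi =>
      (monomial_mem_restrictSupport K).mpr (Or.inl (mem_variablesIn.mp hi))
    have hcard : (variablesIn O).card ≤ k := by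
      by_contra! hlt
      obtain ⟨S, hSO, hS⟩ := Finset.exists_subset_card_eq hlt.le
      obtain ⟨i, hiO, hiS⟩ := Finset.exists_mem_notMem_of_card_lt_card (hS.trans_lt hlt)
      obtain ⟨φ, hφS, -, hφsub, -, hφX⟩ := exists_elimination K (k := k) S hS
      have hle : Submodule.span K (X '' (S : Set (Fin n))) ≤
          restrictSupport K (O : Set (Fin n →₀ ℕ)) := by
        rw [Submodule.span_le]
        rintro _ ⟨s, hs, rfl⟩
        exact hX s (hSO hs)
      have h0 := Submodule.disjoint_def.mp h.disjoint _ (hφsub (X i))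
        (Submodule.sub_mem _ (hX i hiO) (hle (hφX i)))
      have hmem := hφS (X i)
      rw [← sub_eq_zero.mp h0, X_mem_supported] at hmem
      exact hiS hmem
    obtain ⟨S, hOS, -, hS⟩ := Finset.exists_subsuperset_card_eq
      (Finset.subset_univ (variablesIn O)) hcard (by simpa using hkn)
    have hle : (O : Set (Fin n →₀ ℕ)) ⊆ quadMonomials S := fun m hm =>
      ⟨hdeg m hm, (hO.support_subset_variablesIn hm).trans hOS⟩
    have hS' := isCompl_quadMonomials K hS
    have heq : restrictSupport K (O : Set (Fin n →₀ ℕ)) = restrictSupport K (quadMonomials S) :=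
      eq_of_le_of_inf_le_of_le_sup (restrictSupport_mono K hle)
        (hS'.symm.inf_eq_bot.trans_le bot_le) (le_top.trans h.symm.sup_eq_top.ge)
    refine ⟨S, hS, hle.antisymm fun m hm => ?_⟩
    have hm' : monomial m (1 : K) ∈ restrictSupport K (O : Set (Fin n →₀ ℕ)) :=
      heq ▸ (monomial_mem_restrictSupport K).mpr (Or.inl hm)
    exact ((monomial_mem_restrictSupport K).mp hm').resolve_right one_ne_zero
  · rintro ⟨S, hS, hOS⟩
    rw [hOS]
    exact isCompl_quadMonomials K hS

theorem finiteDimensional_quotient_span_Fnk (K : Type*) [Field K] [CharZero K] {n k : ℕ}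
    (hkn : k ≤ n) :
    FiniteDimensional K (MvPolynomial (Fin n) K ⧸ Ideal.span (Fnk K n k)) := by
  obtain ⟨S, -, hS⟩ := Finset.exists_subset_card_eq
    (s := (Finset.univ : Finset (Fin n))) (n := k) (by simpa using hkn)
  have := (finite_quadMonomials S).to_subtype
  have hfin : FiniteDimensional K (restrictSupport K (quadMonomials S)) :=
    (basisRestrictSupport K (quadMonomials S)).finiteDimensional_of_finite
  have : FiniteDimensional K
      (MvPolynomial (Fin n) K ⧸ (Ideal.span (Fnk K n k)).restrictScalars K) :=
    Module.Finite.equiv (Submodule.quotientEquivOfIsCompl _ _ (isCompl_quadMonomials K hS)).symm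
  exact Module.Finite.equiv
    (Submodule.Quotient.restrictScalarsEquiv K (Ideal.span (Fnk K n k)))

/-- `F_{n,k}` generates a zero-dimensional ideal, and an order
ideal `O` supports a border basis of `⟨F_{n,k}⟩` iff `O^{=1}` consists of `k`
(distinct) variables, `O^{=2} = {x·y : x, y ∈ O^{=1}}` and `O^{=ℓ} = ∅` for
all `ℓ ≥ 3`. -/
theorem Fnk_orderIdeals {K : Type*} [Field K] [CharZero K] (n k : ℕ)
    (hk1 : 1 ≤ k) (hkn : k ≤ n) :
    FiniteDimensional K (MvPolynomial (Fin n) K ⧸ Ideal.span (Fnk K n k)) ∧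
    ∀ O : Finset (Fin n →₀ ℕ), IsOrderIdeal O →
      (IsCompl (Submodule.restrictScalars K (Ideal.span (Fnk K n k)))
          (monSpan K (O : Set (Fin n →₀ ℕ))) ↔
        ((O.filter fun m => mdeg m = 1).card = k ∧
         (∀ m : Fin n →₀ ℕ, (m ∈ O ∧ mdeg m = 2) ↔
            ∃ a b : Fin n →₀ ℕ, (a ∈ O ∧ mdeg a = 1) ∧ (b ∈ O ∧ mdeg b = 1) ∧
              m = a + b) ∧
         (∀ l : ℕ, 3 ≤ l → ∀ m ∈ O, mdeg m ≠ l))) := by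
  refine ⟨finiteDimensional_quotient_span_Fnk K hkn, fun O hO => ?_⟩
  rw [isOrderIdeal_conditions_iff hk1 hO, monSpan_eq_restrictSupport]
  exact isCompl_iff_exists_quadMonomials K hkn hO
end
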